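/- Let G be a simple graph on n vertices. Then D_2(G) ≥ (q_n(G)/4)·n, where D_2(G) is the minimum number of edges whose removal makes G bipartite and q_n(G) is the smallest eigenvalue of the signless Laplacian matrix of G. -/

import Mathlib

/-- `D2 G` is the minimum number of edges which have to be removed from `G` to make it
bipartite: the minimum over all vertex subsets `S` of the number of edges with both
endpoints in `S` plus the number of edges with both endpoints outside `S`. -/
noncomputable def D2 {V : Type*} [Fintype V] [DecidableEq V]
    (G : SimpleGraph V) [DecidableRel G.Adj] : ℕ :=
  ⨅ S : Finset V,
    ((G.edgeFinset.filter fun e => ∀ v ∈ e, v ∈ S).card +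
      (G.edgeFinset.filter fun e => ∀ v ∈ e, v ∉ S).card)

open scoped Matrix

/-- The Rayleigh quotient lower bound: the quadratic form of a real Hermitian matrix dominates
its smallest eigenvalue times the squared Euclidean norm. -/
theorem Matrix.IsHermitian.iInf_eigenvalues_mul_dotProduct_le {n : Type*} [Fintype n]
    [DecidableEq n] {A : Matrix n n ℝ} (hA : A.IsHermitian) (x : n → ℝ) :
    (⨅ i, hA.eigenvalues i) * (x ⬝ᵥ x) ≤ x ⬝ᵥ (A *ᵥ x) := by
  set c := ⨅ i, hA.eigenvalues i
  have hB : (A - algebraMap ℝ (Matrix n n ℝ) c).IsHermitian := by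
    rw [Algebra.algebraMap_eq_smul_one]
    exact hA.sub (Matrix.isHermitian_one.smul (IsSelfAdjoint.all c))
  have hpos : (A - algebraMap ℝ (Matrix n n ℝ) c).PosSemidef := by
    refine hB.posSemidef_iff_eigenvalues_nonneg.2 fun i => ?_
    have hi := hB.eigenvalues_mem_spectrum_real i
    rw [← spectrum.sub_singleton_eq, hA.spectrum_real_eq_range_eigenvalues] at hi
    obtain ⟨_, ⟨j, rfl⟩, _, rfl, hj⟩ := hi
    rw [← hj]
    exact sub_nonneg.2 (ciInf_le (Set.finite_range _).bddBelow j)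
  have h := hpos.dotProduct_mulVec_nonneg x
  simp only [star_trivial, Algebra.algebraMap_eq_smul_one, Matrix.sub_mulVec, Matrix.smul_mulVec,
    Matrix.one_mulVec, dotProduct_sub, dotProduct_smul, smul_eq_mul] at h
  linarith

namespace SimpleGraph

variable {V : Type*} [Fintype V] [DecidableEq V] (G : SimpleGraph V) [DecidableRel G.Adj]

/-- The signless Laplacian factors through the incidence matrix. -/
theorem degMatrix_add_adjMatrix_eq_incMatrix_mul_transpose :
    G.degMatrix ℝ + G.adjMatrix ℝ = G.incMatrix ℝ * (G.incMatrix ℝ)ᵀ := by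
  rw [incMatrix_mul_transpose]
  ext a b
  by_cases h : a = b
  · subst h
    simp [degMatrix]
  · simp [degMatrix, h]

/-- The `e`-coordinate of the transposed incidence matrix applied to `x` is the sum of `x` over
the endpoints of `e`. -/
theorem incMatrix_transpose_mulVec_apply {a b : V} (h : G.Adj a b) (x : V → ℝ) :
    ((G.incMatrix ℝ)ᵀ *ᵥ x) s(a, b) = x a + x b := by
  have hinc (v : V) : G.incMatrix ℝ v s(a, b) * x v =
      if v ∈ ({a, b} : Finset V) then x v else 0 := by
    simp [incMatrix_apply', mk'_mem_incidenceSet_iff, h]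
  simp only [Matrix.mulVec, dotProduct, Matrix.transpose_apply, hinc]
  rw [Finset.sum_ite_mem, Finset.univ_inter, Finset.sum_pair h.ne]

/-- The quadratic form of the signless Laplacian at the `±1`-vector of a vertex subset is four
times the number of edges not crossing the corresponding cut. -/
theorem dotProduct_degMatrix_add_adjMatrix_mulVec_sign (S : Finset V) :
    (fun v => if v ∈ S then (1 : ℝ) else -1) ⬝ᵥ
        ((G.degMatrix ℝ + G.adjMatrix ℝ) *ᵥ fun v => if v ∈ S then (1 : ℝ) else -1) =
      4 * ((G.edgeFinset.filter fun e => ∀ v ∈ e, v ∈ S).card +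
        (G.edgeFinset.filter fun e => ∀ v ∈ e, v ∉ S).card) := by
  set x : V → ℝ := fun v => if v ∈ S then (1 : ℝ) else -1 with hx
  rw [degMatrix_add_adjMatrix_eq_incMatrix_mul_transpose, ← Matrix.mulVec_mulVec,
    Matrix.dotProduct_mulVec, ← Matrix.mulVec_transpose, dotProduct,
    ← Finset.sum_subset (Finset.subset_univ G.edgeFinset)]
  · rw [Finset.card_filter, Finset.card_filter, Nat.cast_sum, Nat.cast_sum,
      ← Finset.sum_add_distrib, Finset.mul_sum]
    refine Finset.sum_congr rfl fun e he => ?_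
    induction e with
    | h a b =>
      rw [incMatrix_transpose_mulVec_apply G (by simpa using he)]
      by_cases ha : a ∈ S <;> by_cases hb : b ∈ S <;> norm_num [hx, ha, hb]
  · intro e _ he
    have hzero : ((G.incMatrix ℝ)ᵀ *ᵥ x) e = 0 :=
      Finset.sum_eq_zero fun v _ => mul_eq_zero_of_left
        (G.incMatrix_of_notMem_incidenceSet fun h => he (mem_edgeFinset.2 h.1)) _
    rw [hzero, zero_mul]

end SimpleGraph

/-- For every `n`-vertex graph `G`, `D₂(G) ≥ (qₙ(G) / 4) * n`, where `qₙ(G)` is the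
smallest eigenvalue of the signless Laplacian matrix of `G`. -/
theorem D2_ge_smallest_signless_laplacian_eigenvalue
    {V : Type*} [Fintype V] [DecidableEq V] [Nonempty V]
    (G : SimpleGraph V) [DecidableRel G.Adj]
    (hQ : (G.degMatrix ℝ + G.adjMatrix ℝ).IsHermitian) :
    (D2 G : ℝ) ≥ (⨅ i, hQ.eigenvalues i) / 4 * (Fintype.card V : ℝ) := by
  obtain ⟨S, hS⟩ : D2 G ∈ Set.range fun S : Finset V =>
      (G.edgeFinset.filter fun e => ∀ v ∈ e, v ∈ S).card +
        (G.edgeFinset.filter fun e => ∀ v ∈ e, v ∉ S).card :=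
    Nat.sInf_mem (Set.range_nonempty _)
  have h := hQ.iInf_eigenvalues_mul_dotProduct_le fun v => if v ∈ S then (1 : ℝ) else -1
  have hnorm : (fun v => if v ∈ S then (1 : ℝ) else -1) ⬝ᵥ
      (fun v => if v ∈ S then (1 : ℝ) else -1) = Fintype.card V := by
    have hsq (v : V) : (if v ∈ S then (1 : ℝ) else -1) * (if v ∈ S then (1 : ℝ) else -1) = 1 := by
      split_ifs <;> norm_num
    simp only [dotProduct, hsq, Finset.sum_const, Finset.card_univ, nsmul_eq_mul, mul_one]
  rw [G.dotProduct_degMatrix_add_adjMatrix_mulVec_sign, hnorm] at h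
  rw [← hS, Nat.cast_add]
  linarith
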